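/- For every positive integer k, at least one of the following congruences holds: 2^k ≡ 1 (mod 3), 2^k ≡ 2 (mod 5), 2^k ≡ 8 (mod 17), 2^k ≡ 2 (mod 7), 2^k ≡ 8 (mod 13), 2^k ≡ 2^23 (mod 241). -/

import Mathlib

theorem Nat.ModEq.pow_of_modEq_exponent {a d m k r : ℕ} (had : a ^ d ≡ 1 [MOD m])
    (hk : k ≡ r [MOD d]) : a ^ k ≡ a ^ r [MOD m] := by
  have reduce (n : ℕ) : a ^ n ≡ a ^ (n % d) [MOD m] := by
    conv_lhs => rw [← Nat.div_add_mod n d, pow_add, pow_mul]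
    simpa using (had.pow (n / d)).mul_right (a ^ (n % d))
  exact (reduce k).trans (hk ▸ (reduce r).symm)

theorem stmt19 (k : ℕ) (hk : 0 < k) :
    2 ^ k ≡ 1 [MOD 3] ∨ 2 ^ k ≡ 2 [MOD 5] ∨ 2 ^ k ≡ 8 [MOD 17] ∨
    2 ^ k ≡ 2 [MOD 7] ∨ 2 ^ k ≡ 8 [MOD 13] ∨ 2 ^ k ≡ 2 ^ 23 [MOD 241] := by
  have cover : k ≡ 0 [MOD 2] ∨ k ≡ 1 [MOD 4] ∨ k ≡ 3 [MOD 8] ∨ k ≡ 1 [MOD 3] ∨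
      k ≡ 3 [MOD 12] ∨ k ≡ 23 [MOD 24] := by
    simp only [Nat.ModEq]
    omega
  refine cover.imp ?_ (Or.imp ?_ (Or.imp ?_ (Or.imp ?_ (Or.imp ?_ ?_)))) <;>
    exact Nat.ModEq.pow_of_modEq_exponent (by decide)
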